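/- Let 𝒮 = {μ_1, …, μ_m} be a finite set of pmfs on a countable set 𝒳, let h_1, …, h_M be real-valued functions on joint pmfs on 𝒳×𝒴 with constraint levels θ ∈ ℝ^M, and assume feasibility of the robust information rate function R̄(θ). Then every rate R with R > R̄(θ) + log₂( m · (R̄(θ) + 1) ) + 4 is robust one-shot achievable. -/

import Mathlib

open MeasureTheory ProbabilityTheory
open scoped ENNReal

/-- Base-2 entropy of a pmf on a countable type: `H(p) = -∑ p(a) log₂ p(a)`. -/
noncomputable def ent2 {𝒴 : Type*} (p : PMF 𝒴) : ℝ :=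
  ∑' y, -((p y).toReal * Real.logb 2 (p y).toReal)

/-- Joint pmf `μ(x) Q(y|x)` on `𝒳 × 𝒴` induced by a source pmf `μ` and a Markov kernel `Q`. -/
noncomputable def jointPMF {𝒳 𝒴 : Type*} (μ : PMF 𝒳) (Q : 𝒳 → PMF 𝒴) : PMF (𝒳 × 𝒴) :=
  μ.bind fun x => (Q x).map (Prod.mk x)

/-- Summand of the mutual information `I(μ, Q)` (base 2). -/
noncomputable def miSummand {𝒳 𝒴 : Type*} (μ : PMF 𝒳) (Q : 𝒳 → PMF 𝒴) (p : 𝒳 × 𝒴) : ℝ :=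
  ((μ p.1) * (Q p.1 p.2)).toReal *
    Real.logb 2 ((Q p.1 p.2).toReal / ((μ.bind Q) p.2).toReal)

/-- Mutual information (base 2) `I(μ, Q) = ∑_{x,y} μ(x)Q(y|x) log₂ (Q(y|x)/q(y))`. -/
noncomputable def mutInfo {𝒳 𝒴 : Type*} (μ : PMF 𝒳) (Q : 𝒳 → PMF 𝒴) : ℝ :=
  ∑' p, miSummand μ Q p

/-- `κ` is a regular conditional distribution of the (discrete-valued) random variable `Y`
given `Z`, under the probability measure `P`. -/
def IsCondDistrib {Ω 𝒴 𝒵 : Type*} [MeasurableSpace Ω] [MeasurableSpace 𝒵]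
    (P : Measure Ω) (Y : Ω → 𝒴) (Z : Ω → 𝒵) (κ : 𝒵 → PMF 𝒴) : Prop :=
  (∀ y, Measurable fun z => κ z y) ∧
    ∀ (y : 𝒴) (A : Set 𝒵), MeasurableSet A →
      P {ω | Y ω = y ∧ Z ω ∈ A} = ∫⁻ z in A, κ z y ∂(P.map Z)

/-- The constraint set `𝓛(θ)` of Markov kernels `Q` with `h_i(μ_α ⊗ Q) ≤ θ_i` for all
sources `μ_α` in the family and all `i`. -/
def constraintSet {𝒳 𝒴 ι : Type*} {M : ℕ} (μS : ι → PMF 𝒳)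
    (h : Fin M → PMF (𝒳 × 𝒴) → ℝ) (θ : Fin M → ℝ) : Set (𝒳 → PMF 𝒴) :=
  {Q | ∀ (α : ι) (i : Fin M), h i (jointPMF (μS α) Q) ≤ θ i}

/-- The robust information rate function
`R̄(θ) = inf_{Q ∈ 𝓛(θ)} max_α I(μ_α, Q)` (the infimum being over the kernels in `𝓛(θ)`
with finite worst-case mutual information, the others having value `+∞`). -/
noncomputable def Rbar {𝒳 𝒴 ι : Type*} {M : ℕ} (μS : ι → PMF 𝒳)
    (h : Fin M → PMF (𝒳 × 𝒴) → ℝ) (θ : Fin M → ℝ) : ℝ :=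
  sInf {r | ∃ Q ∈ constraintSet μS h θ,
    (∀ α, Summable (miSummand (μS α) Q)) ∧ r = ⨆ α, mutInfo (μS α) Q}

/-- Feasibility of the robust information rate function: some kernel in `𝓛(θ)` has finite
worst-case mutual information. -/
def RIRFFeasible {𝒳 𝒴 ι : Type*} {M : ℕ} (μS : ι → PMF 𝒳)
    (h : Fin M → PMF (𝒳 × 𝒴) → ℝ) (θ : Fin M → ℝ) : Prop :=
  ∃ Q ∈ constraintSet μS h θ, ∀ α, Summable (miSummand (μS α) Q)

/-- A rate `R` is robust one-shot achievable: there are a source of common randomness `Z ∼ PZ`,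
a measurable encoder `f` and a measurable decoder `g` such that for every source `μ_α` of the
family, taking `X ∼ μ_α` independent of `Z` (the two coordinates of the product space),
`M = f(X, Z)` and `Y = g(M, Z)`, one has `H(M | Z) ≤ R` and `h_i(P_{X,Y}) ≤ θ_i` for all `i`. -/
def RobustOneShotAchievable {𝒳 𝒴 : Type*} [MeasurableSpace 𝒳] [MeasurableSpace 𝒴]
    {ι : Type*} {M : ℕ} (μS : ι → PMF 𝒳) (h : Fin M → PMF (𝒳 × 𝒴) → ℝ)
    (θ : Fin M → ℝ) (R : ℝ) : Prop :=
  ∃ (𝒵 : Type) (_ : MeasurableSpace 𝒵) (PZ : Measure 𝒵)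
    (f : 𝒳 × 𝒵 → ℕ) (g : ℕ × 𝒵 → 𝒴),
    IsProbabilityMeasure PZ ∧ Measurable f ∧ Measurable g ∧
    ∀ α : ι,
      (∃ κ : 𝒵 → PMF ℕ,
        IsCondDistrib ((μS α).toMeasure.prod PZ) (fun ω => f ω) Prod.snd κ ∧
        ∫ z, ent2 (κ z) ∂PZ ≤ R) ∧
      ∃ p : PMF (𝒳 × 𝒴),
        (((μS α).toMeasure.prod PZ).map fun ω => (ω.1, g (f ω, ω.2))) = p.toMeasure ∧
        ∀ i, h i p ≤ θ i

section ExponentialRace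

theorem lintegral_expMeasure_one {f : ℝ → ℝ≥0∞} (hf : Measurable f) :
    ∫⁻ e, f e ∂(expMeasure 1) = ∫⁻ e, exponentialPDF 1 e * f e := by
  have hm : Measurable (exponentialPDF 1) := (measurable_exponentialPDFReal 1).ennreal_ofReal
  exact lintegral_withDensity_eq_lintegral_mul _ hm hf

theorem expMeasure_one_apply {s : Set ℝ} (hs : MeasurableSet s) :
    expMeasure 1 s = ∫⁻ e in s, exponentialPDF 1 e :=
  withDensity_apply _ hs

instance isProbabilityMeasure_expMeasure_one : IsProbabilityMeasure (expMeasure 1) :=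
  isProbabilityMeasure_expMeasure one_pos

theorem expMeasure_one_Ici_le (a : ℝ) :
    expMeasure 1 (Set.Ici a) ≤ ENNReal.ofReal (Real.exp (-a)) := by
  rcases lt_or_ge a 0 with ha | ha
  · refine prob_le_one.trans ?_
    rw [ENNReal.one_le_ofReal]
    exact Real.one_le_exp (by linarith)
  · rw [expMeasure_one_apply measurableSet_Ici]
    calc ∫⁻ e in Set.Ici a, exponentialPDF 1 e
        ≤ ∫⁻ e in Set.Ici a, ENNReal.ofReal (Real.exp (-a)) * exponentialPDF 1 (e - a) := by
          refine setLIntegral_mono' measurableSet_Ici fun e he => ?_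
          have he' : a ≤ e := he
          rw [exponentialPDF_of_nonneg (ha.trans he'), exponentialPDF_of_nonneg (by linarith),
            ← ENNReal.ofReal_mul (Real.exp_nonneg _)]
          refine ENNReal.ofReal_le_ofReal (le_of_eq ?_)
          simp only [one_mul, ← Real.exp_add]
          ring_nf
      _ ≤ ∫⁻ e, ENNReal.ofReal (Real.exp (-a)) * exponentialPDF 1 (e - a) :=
          setLIntegral_le_lintegral _ _
      _ = ENNReal.ofReal (Real.exp (-a)) := by
          rw [lintegral_const_mul' _ _ ENNReal.ofReal_ne_top,
            lintegral_sub_right_eq_self (exponentialPDF 1) a,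
            lintegral_exponentialPDF_eq_one one_pos, mul_one]

theorem expMeasure_one_Icc_le (a b : ℝ) :
    expMeasure 1 (Set.Icc a b) ≤ ENNReal.ofReal (Real.exp (-a)) * ENNReal.ofReal b := by
  rw [expMeasure_one_apply measurableSet_Icc]
  calc ∫⁻ e in Set.Icc a b, exponentialPDF 1 e
      ≤ ∫⁻ e in Set.Icc a b,
          (Set.Icc 0 b).indicator (fun _ => ENNReal.ofReal (Real.exp (-a))) e := by
        refine setLIntegral_mono' measurableSet_Icc fun e he => ?_
        rcases lt_or_ge e 0 with h0 | h0
        · rw [exponentialPDF_of_neg h0]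
          exact zero_le
        · rw [Set.indicator_of_mem (show e ∈ Set.Icc 0 b from ⟨h0, he.2⟩),
            exponentialPDF_of_nonneg h0]
          refine ENNReal.ofReal_le_ofReal ?_
          simpa using he.1
    _ ≤ ∫⁻ e, (Set.Icc 0 b).indicator (fun _ => ENNReal.ofReal (Real.exp (-a))) e :=
        setLIntegral_le_lintegral _ _
    _ = ENNReal.ofReal (Real.exp (-a)) * ENNReal.ofReal b := by
        rw [lintegral_indicator_const measurableSet_Icc, Real.volume_Icc, sub_zero]

theorem expMeasure_one_Iio_zero : expMeasure 1 (Set.Iio 0) = 0 := by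
  rw [expMeasure_one_apply measurableSet_Iio]
  exact lintegral_exponentialPDF_of_nonpos le_rfl

theorem expMeasure_one_Iic_le (b : ℝ) : expMeasure 1 (Set.Iic b) ≤ ENNReal.ofReal b := by
  calc expMeasure 1 (Set.Iic b)
      ≤ expMeasure 1 (Set.Iio 0 ∪ Set.Icc 0 b) := by
        refine measure_mono fun e he => ?_
        rcases lt_or_ge e 0 with h | h
        · exact Or.inl h
        · exact Or.inr ⟨h, he⟩
    _ ≤ ENNReal.ofReal b := by
        refine (measure_union_le _ _).trans ?_
        rw [expMeasure_one_Iio_zero, zero_add]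
        simpa using expMeasure_one_Icc_le 0 b

theorem lintegral_exp_neg_mul_expMeasure_one {c : ℝ} (hc : 0 ≤ c) :
    ∫⁻ e, ENNReal.ofReal (Real.exp (-(c * e))) ∂(expMeasure 1) = ENNReal.ofReal (1 + c)⁻¹ := by
  rw [lintegral_expMeasure_one (by fun_prop)]
  have h : ∀ e, exponentialPDF 1 e * ENNReal.ofReal (Real.exp (-(c * e))) =
      ENNReal.ofReal (1 + c)⁻¹ * exponentialPDF (1 + c) e := by
    intro e
    rcases lt_or_ge e 0 with h0 | h0
    · simp [exponentialPDF_of_neg h0]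
    · have : (1 + c) ≠ 0 := by positivity
      rw [exponentialPDF_of_nonneg h0, exponentialPDF_of_nonneg h0,
        ← ENNReal.ofReal_mul (by positivity), ← ENNReal.ofReal_mul (by positivity),
        inv_mul_cancel_left₀ this, one_mul, one_mul, ← Real.exp_add]
      ring_nf
  simp_rw [h]
  rw [lintegral_const_mul' _ _ ENNReal.ofReal_ne_top,
    lintegral_exponentialPDF_eq_one (by positivity), mul_one]

theorem lintegral_mul_exp_neg_mul_expMeasure_one {c : ℝ} (hc : 0 ≤ c) :
    ∫⁻ e, ENNReal.ofReal (Real.exp (-(c * e))) * ENNReal.ofReal e ∂(expMeasure 1) =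
      ENNReal.ofReal ((1 + c)⁻¹ ^ 2) := by
  rw [lintegral_expMeasure_one (by fun_prop)]
  have h : ∀ e, exponentialPDF 1 e * (ENNReal.ofReal (Real.exp (-(c * e))) * ENNReal.ofReal e) =
      ENNReal.ofReal ((1 + c)⁻¹ ^ 2) * gammaPDF 2 (1 + c) e := by
    intro e
    rcases lt_or_ge e 0 with h0 | h0
    · simp [exponentialPDF_of_neg h0, gammaPDF_of_neg h0]
    · have h1 : (1 + c) ≠ 0 := by positivity
      have h2 : (2 : ℝ) - 1 = 1 := by norm_num
      rw [exponentialPDF_of_nonneg h0, gammaPDF_of_nonneg h0,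
        ← ENNReal.ofReal_mul (by positivity), ← ENNReal.ofReal_mul (by positivity),
        ← ENNReal.ofReal_mul (by positivity), Real.Gamma_two, h2, Real.rpow_one, div_one,
        Real.rpow_two]
      congr 1
      have h3 : Real.exp (-((1 + c) * e)) = Real.exp (-(1 * e)) * Real.exp (-(c * e)) := by
        rw [← Real.exp_add]
        ring_nf
      rw [h3]
      field_simp
  simp_rw [h]
  rw [lintegral_const_mul' _ _ ENNReal.ofReal_ne_top,
    lintegral_gammaPDF_eq_one two_pos (by positivity), mul_one]

variable {𝒴 : Type}

/-- The law of a family of independent standard exponential clocks indexed by `𝒴`. -/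
noncomputable def clockMeasure (𝒴 : Type) : Measure (𝒴 → ℝ) :=
  Measure.infinitePi fun _ : 𝒴 => expMeasure 1

instance : IsProbabilityMeasure (clockMeasure 𝒴) := by
  unfold clockMeasure
  infer_instance

theorem clockMeasure_eval {s : Set ℝ} (hs : MeasurableSet s) (y : 𝒴) :
    clockMeasure 𝒴 {z | z y ∈ s} = expMeasure 1 s := by
  have h := (measurePreserving_eval_infinitePi (fun _ : 𝒴 => expMeasure 1) y).measure_preimage
    hs.nullMeasurableSet
  exact h

theorem map_update_clockMeasure [DecidableEq 𝒴] (y : 𝒴) :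
    ((expMeasure 1).prod (clockMeasure 𝒴)).map (fun q => Function.update q.2 y q.1) =
      clockMeasure 𝒴 := by
  have hmeas : Measurable fun q : ℝ × (𝒴 → ℝ) => Function.update q.2 y q.1 :=
    measurable_update'.comp measurable_swap
  refine Measure.eq_infinitePi _ fun s t ht => ?_
  rw [Measure.map_apply hmeas (.pi s.countable_toSet fun i _ => ht i)]
  have hset : (fun q : ℝ × (𝒴 → ℝ) => Function.update q.2 y q.1) ⁻¹' (Set.pi s t) =
      (if y ∈ s then t y else Set.univ) ×ˢ (Set.pi (s.erase y : Finset 𝒴) t) := by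
    ext q
    simp only [Set.mem_preimage, Set.mem_pi, Finset.mem_coe, Set.mem_prod, Finset.mem_erase]
    constructor
    · intro h
      refine ⟨?_, fun i hi => ?_⟩
      · split_ifs with hy
        · simpa using h y hy
        · trivial
      · simpa [Function.update_of_ne hi.1] using h i hi.2
    · rintro ⟨h1, h2⟩ i hi
      by_cases hiy : i = y
      · subst hiy
        simpa [hi] using h1
      · simpa [Function.update_of_ne hiy] using h2 i ⟨hiy, hi⟩
  rw [hset, Measure.prod_prod, clockMeasure, Measure.infinitePi_pi _ fun i _ => ht i]
  split_ifs with hy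
  · exact Finset.mul_prod_erase s (fun i => expMeasure 1 (t i)) hy
  · rw [measure_univ, one_mul, Finset.erase_eq_of_notMem hy]

theorem clockMeasure_dependent_box (y : 𝒴) (F : Finset 𝒴) (hF : y ∉ F) (S : 𝒴 → ℝ → Set ℝ)
    (hS : ∀ i, MeasurableSet {q : ℝ × ℝ | q.2 ∈ S i q.1}) :
    clockMeasure 𝒴 {z | ∀ i ∈ F, z i ∈ S i (z y)} =
      ∫⁻ e, ∏ i ∈ F, expMeasure 1 (S i e) ∂(expMeasure 1) := by
  classical
  have hmeas : Measurable fun q : ℝ × (𝒴 → ℝ) => Function.update q.2 y q.1 :=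
    measurable_update'.comp measurable_swap
  have hset : MeasurableSet {z : 𝒴 → ℝ | ∀ i ∈ F, z i ∈ S i (z y)} := by
    have : {z : 𝒴 → ℝ | ∀ i ∈ F, z i ∈ S i (z y)} =
        ⋂ i ∈ F, (fun z : 𝒴 → ℝ => (z y, z i)) ⁻¹' {q : ℝ × ℝ | q.2 ∈ S i q.1} := by
      ext z
      simp
    rw [this]
    exact F.measurableSet_biInter fun i _ =>
      ((measurable_pi_apply y).prodMk (measurable_pi_apply i)) (hS i)
  conv_lhs => rw [← map_update_clockMeasure y]
  rw [Measure.map_apply hmeas hset, Measure.prod_apply (hmeas hset)]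
  refine lintegral_congr fun e => ?_
  have hsec : Prod.mk e ⁻¹' ((fun q : ℝ × (𝒴 → ℝ) => Function.update q.2 y q.1) ⁻¹'
      {z | ∀ i ∈ F, z i ∈ S i (z y)}) = Set.pi F fun i => S i e := by
    ext z
    simp only [Set.mem_preimage, Set.mem_ofPred_eq, Function.update_self, Set.mem_pi,
      Finset.mem_coe]
    refine forall₂_congr fun i hi => ?_
    rw [Function.update_of_ne (ne_of_mem_of_not_mem hi hF)]
  rw [hsec, clockMeasure, Measure.infinitePi_pi]
  intro i _
  exact measurable_prodMk_left (hS i)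

/-- `y` wins the race in which the clock of `y'` is sped up by the factor `p y'`. -/
def IsRaceWinner (p : 𝒴 → ℝ) (z : 𝒴 → ℝ) (y : 𝒴) : Prop :=
  0 < p y ∧ ∀ y', z y * p y' ≤ z y' * p y

theorem measurableSet_isRaceWinner [Countable 𝒴] (p : 𝒴 → ℝ) (y : 𝒴) :
    MeasurableSet {z | IsRaceWinner p z y} := by
  have : {z | IsRaceWinner p z y} =
      {_z | 0 < p y} ∩ ⋂ y', {z : 𝒴 → ℝ | z y * p y' ≤ z y' * p y} := by
    ext z
    simp [IsRaceWinner]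
  rw [this]
  exact (MeasurableSet.const _).inter (.iInter fun y' =>
    measurableSet_le (by fun_prop) (by fun_prop))

theorem prod_ofReal_exp_neg_div (p : 𝒴 → ℝ) (y : 𝒴) (F : Finset 𝒴) (e : ℝ) :
    ∏ i ∈ F, ENNReal.ofReal (Real.exp (-(e * p i / p y))) =
      ENNReal.ofReal (Real.exp (-((∑ i ∈ F, p i) / p y * e))) := by
  rw [← ENNReal.ofReal_prod_of_nonneg fun i _ => (Real.exp_nonneg _), ← Real.exp_sum,
    Finset.sum_neg_distrib, Finset.sum_div, Finset.sum_mul]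
  congr 3
  exact Finset.sum_congr rfl fun i _ => by ring

theorem clockMeasure_finite_race_le {p : 𝒴 → ℝ} (hp : ∀ y, 0 ≤ p y) {y : 𝒴} (hy : 0 < p y)
    {F : Finset 𝒴} (hF : y ∉ F) :
    clockMeasure 𝒴 {z | ∀ i ∈ F, z i ∈ Set.Ici (z y * p i / p y)} ≤
      ENNReal.ofReal (p y / (p y + ∑ i ∈ F, p i)) := by
  have hsum : 0 ≤ ∑ i ∈ F, p i := Finset.sum_nonneg fun i _ => hp i
  rw [clockMeasure_dependent_box y F hF (fun i e => Set.Ici (e * p i / p y))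
    (fun i => measurableSet_le (f := fun q : ℝ × ℝ => q.1 * p i / p y) (by fun_prop)
      measurable_snd)]
  calc ∫⁻ e, ∏ i ∈ F, expMeasure 1 (Set.Ici (e * p i / p y)) ∂(expMeasure 1)
      ≤ ∫⁻ e, ENNReal.ofReal (Real.exp (-((∑ i ∈ F, p i) / p y * e))) ∂(expMeasure 1) := by
        refine lintegral_mono fun e => ?_
        rw [← prod_ofReal_exp_neg_div]
        exact Finset.prod_le_prod' fun i _ => expMeasure_one_Ici_le _
    _ = _ := by
        rw [lintegral_exp_neg_mul_expMeasure_one (by positivity)]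
        congr 1
        field_simp

theorem clockMeasure_finite_race_before_le {p : 𝒴 → ℝ} (hp : ∀ y, 0 ≤ p y) {y y' : 𝒴}
    (hy : 0 < p y) {F : Finset 𝒴} (hF : y ∉ F) (hy' : y' ∈ F) {r : ℝ} (hr : 0 ≤ r) :
    clockMeasure 𝒴 {z | (∀ i ∈ F, z i ∈ Set.Ici (z y * p i / p y)) ∧ z y' ≤ z y * r} ≤
      ENNReal.ofReal ((p y / (p y + ∑ i ∈ F, p i)) ^ 2 * r) := by
  classical
  have hsum : 0 ≤ ∑ i ∈ F, p i := Finset.sum_nonneg fun i _ => hp i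
  let S : 𝒴 → ℝ → Set ℝ := fun i e =>
    if i = y' then Set.Icc (e * p i / p y) (e * r) else Set.Ici (e * p i / p y)
  have hS : ∀ i, MeasurableSet {q : ℝ × ℝ | q.2 ∈ S i q.1} := by
    intro i
    by_cases h : i = y'
    · simp only [S, if_pos h, Set.mem_Icc]
      exact (measurableSet_le (f := fun q : ℝ × ℝ => q.1 * p i / p y) (by fun_prop)
        measurable_snd).inter (measurableSet_le (g := fun q : ℝ × ℝ => q.1 * r) measurable_snd
          (by fun_prop))
    · simp only [S, if_neg h, Set.mem_Ici]
      exact measurableSet_le (f := fun q : ℝ × ℝ => q.1 * p i / p y) (by fun_prop) measurable_snd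
  calc clockMeasure 𝒴 {z | (∀ i ∈ F, z i ∈ Set.Ici (z y * p i / p y)) ∧ z y' ≤ z y * r}
      ≤ clockMeasure 𝒴 {z | ∀ i ∈ F, z i ∈ S i (z y)} := by
        refine measure_mono fun z hz i hi => ?_
        by_cases h : i = y'
        · simp only [S, if_pos h]
          exact ⟨hz.1 i hi, h ▸ hz.2⟩
        · simp only [S, if_neg h]
          exact hz.1 i hi
    _ = ∫⁻ e, ∏ i ∈ F, expMeasure 1 (S i e) ∂(expMeasure 1) :=
        clockMeasure_dependent_box y F hF S hS
    _ ≤ ∫⁻ e, ENNReal.ofReal (Real.exp (-((∑ i ∈ F, p i) / p y * e))) * ENNReal.ofReal e *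
          ENNReal.ofReal r ∂(expMeasure 1) := by
        refine lintegral_mono fun e => ?_
        have hle : ∀ i, expMeasure 1 (S i e) ≤ ENNReal.ofReal (Real.exp (-(e * p i / p y))) *
            (if i = y' then ENNReal.ofReal (e * r) else 1) := by
          intro i
          by_cases h : i = y'
          · simp only [S, if_pos h]
            exact expMeasure_one_Icc_le _ _
          · simp only [S, if_neg h, mul_one]
            exact expMeasure_one_Ici_le _
        refine (Finset.prod_le_prod' fun i _ => hle i).trans (le_of_eq ?_)
        rw [Finset.prod_mul_distrib, prod_ofReal_exp_neg_div, Finset.prod_ite_eq', if_pos hy',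
          ENNReal.ofReal_mul' hr, mul_assoc]
    _ = _ := by
        rw [lintegral_mul_const' _ _ ENNReal.ofReal_ne_top,
          lintegral_mul_exp_neg_mul_expMeasure_one (by positivity),
          ← ENNReal.ofReal_mul (by positivity)]
        congr 3
        field_simp

theorem clockMeasure_isRaceWinner_le {p : 𝒴 → ℝ} (hp : ∀ y, 0 ≤ p y) (hp1 : HasSum p 1) (y : 𝒴) :
    clockMeasure 𝒴 {z | IsRaceWinner p z y} ≤ ENNReal.ofReal (p y) := by
  classical
  by_cases hy : 0 < p y
  · have hlim : Filter.Tendsto (fun F : Finset 𝒴 => ENNReal.ofReal (p y / ∑ i ∈ F, p i))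
        Filter.atTop (nhds (ENNReal.ofReal (p y / 1))) :=
      ENNReal.tendsto_ofReal (tendsto_const_nhds.div hp1 one_ne_zero)
    rw [div_one] at hlim
    refine ge_of_tendsto hlim ?_
    filter_upwards [Filter.eventually_ge_atTop ({y} : Finset 𝒴)] with F hF
    rw [← Finset.add_sum_erase F p (hF (Finset.mem_singleton_self y))]
    refine (measure_mono fun z hz i _ => ?_).trans
      (clockMeasure_finite_race_le hp hy (Finset.notMem_erase y F))
    exact (div_le_iff₀ hy).2 (hz.2 i)
  · simp [IsRaceWinner, hy]

theorem clockMeasure_isRaceWinner_before_le {p : 𝒴 → ℝ} (hp : ∀ y, 0 ≤ p y) (hp1 : HasSum p 1)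
    {y y' : 𝒴} (hyy' : y' ≠ y) {r : ℝ} (hr : 0 ≤ r) :
    clockMeasure 𝒴 {z | IsRaceWinner p z y ∧ z y' ≤ z y * r} ≤ ENNReal.ofReal (p y ^ 2 * r) := by
  classical
  by_cases hy : 0 < p y
  · have hlim : Filter.Tendsto
        (fun F : Finset 𝒴 => ENNReal.ofReal ((p y / ∑ i ∈ F, p i) ^ 2 * r))
        Filter.atTop (nhds (ENNReal.ofReal ((p y / 1) ^ 2 * r))) :=
      ENNReal.tendsto_ofReal (((tendsto_const_nhds.div hp1 one_ne_zero).pow 2).mul_const r)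
    rw [div_one] at hlim
    refine ge_of_tendsto hlim ?_
    filter_upwards [Filter.eventually_ge_atTop ({y} : Finset 𝒴),
      Filter.eventually_ge_atTop ({y'} : Finset 𝒴)] with F hF hF'
    rw [← Finset.add_sum_erase F p (hF (Finset.mem_singleton_self y))]
    refine (measure_mono fun z hz => ?_).trans
      (clockMeasure_finite_race_before_le hp hy (Finset.notMem_erase y F)
        (Finset.mem_erase.2 ⟨hyy', hF' (Finset.mem_singleton_self y')⟩) hr)
    exact ⟨fun i _ => (div_le_iff₀ hy).2 (hz.1.2 i), hz.2⟩
  · simp [IsRaceWinner, hy]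

theorem ae_nonneg_clockMeasure [Countable 𝒴] : ∀ᵐ z ∂(clockMeasure 𝒴), ∀ y, 0 ≤ z y := by
  rw [ae_all_iff]
  intro y
  rw [ae_iff]
  simp only [not_le]
  exact (clockMeasure_eval measurableSet_Iio y).trans expMeasure_one_Iio_zero

theorem ae_finite_clock_le [Countable 𝒴] {p : 𝒴 → ℝ} (hp : ∀ y, 0 ≤ p y) (hp1 : Summable p) :
    ∀ᵐ z ∂(clockMeasure 𝒴), ∀ t : ℝ, {y | z y ≤ t * p y}.Finite := by
  have h : ∀ᵐ z ∂(clockMeasure 𝒴), ∀ n : ℕ, {y | z y ≤ n * p y}.Finite := by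
    rw [ae_all_iff]
    intro n
    refine ae_finite_setOfPred_mem (s := fun y => {z : 𝒴 → ℝ | z y ≤ n * p y}) (ne_top_of_le_ne_top
      (hp1.mul_left (n : ℝ)).tsum_ofReal_ne_top (ENNReal.tsum_le_tsum fun y => ?_))
    exact (clockMeasure_eval measurableSet_Iic y).trans_le (expMeasure_one_Iic_le _)
  filter_upwards [h] with z hz t
  obtain ⟨n, hn⟩ := exists_nat_ge t
  exact (hz n).subset fun y (hy : z y ≤ t * p y) =>
    hy.trans (mul_le_mul_of_nonneg_right hn (hp y))

theorem ae_exists_isRaceWinner [Countable 𝒴] {p : 𝒴 → ℝ} (hp : ∀ y, 0 ≤ p y) (hp1 : HasSum p 1) :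
    ∀ᵐ z ∂(clockMeasure 𝒴), ∃ y, IsRaceWinner p z y := by
  have hex : ∃ y, 0 < p y := by
    by_contra! hcon
    have : p = 0 := funext fun y => le_antisymm (hcon y) (hp y)
    subst this
    exact zero_ne_one (hasSum_zero.unique hp1)
  obtain ⟨y₀, hy₀⟩ := hex
  filter_upwards [ae_nonneg_clockMeasure, ae_finite_clock_le hp hp1.summable] with z hz hfin
  have hs : {y | 0 < p y ∧ z y ≤ z y₀ / p y₀ * p y}.Finite :=
    (hfin (z y₀ / p y₀)).subset fun y hy => hy.2
  obtain ⟨y, hy, hmin⟩ := hs.exists_minimalFor (fun y => z y / p y) _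
    ⟨y₀, hy₀, by rw [div_mul_cancel₀ _ hy₀.ne']⟩
  refine ⟨y, hy.1, fun y' => ?_⟩
  rcases (hp y').eq_or_lt with h0 | h0
  · rw [← h0, mul_zero]
    exact mul_nonneg (hz y') (hp y)
  · rw [← div_le_div_iff₀ hy.1 h0]
    by_cases hy' : z y' ≤ z y₀ / p y₀ * p y'
    · rcases le_total (z y / p y) (z y' / p y') with h | h
      · exact h
      · exact hmin ⟨h0, hy'⟩ h
    · exact ((div_le_iff₀ hy.1).2 hy.2).trans ((le_div_iff₀ h0).2 (not_le.1 hy').le)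

end ExponentialRace

section RaceRank

variable {𝒴 : Type}

theorem exists_measurable_selection {Z : Type*} [MeasurableSpace Z] [Countable 𝒴] [Nonempty 𝒴]
    [MeasurableSpace 𝒴] (A : 𝒴 → Set Z) (hA : ∀ y, MeasurableSet (A y)) :
    ∃ W : Z → 𝒴, Measurable W ∧ ∀ z y, z ∈ A y → z ∈ A (W z) := by
  classical
  obtain ⟨e, he⟩ := exists_surjective_nat 𝒴
  have hex : ∀ z, ∃ n, z ∈ A (e n) ∨ z ∉ ⋃ y, A y := by
    intro z
    by_cases hz : z ∈ ⋃ y, A y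
    · obtain ⟨y, hy⟩ := Set.mem_iUnion.1 hz
      obtain ⟨n, rfl⟩ := he y
      exact ⟨n, Or.inl hy⟩
    · exact ⟨0, Or.inr hz⟩
  refine ⟨fun z => e (Nat.find (hex z)), ?_, fun z y hy => ?_⟩
  · exact (measurable_of_countable e).comp
      (measurable_find hex fun n => (hA (e n)).union (MeasurableSet.iUnion hA).compl)
  · exact (Nat.find_spec (hex z)).resolve_right fun h => h (Set.mem_iUnion.2 ⟨y, hy⟩)

/-- The clock of `y'`, slowed down by `w y'`, rings before the one of `y`; ties are broken
by the labels `num`. -/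
def Precedes (w : 𝒴 → ℝ) (num : 𝒴 → ℕ) (z : 𝒴 → ℝ) (y' y : 𝒴) : Prop :=
  0 < w y' ∧ (z y' / w y' < z y / w y ∨ (z y' / w y' = z y / w y ∧ num y' < num y))

/-- The number of elements preceding `y`. -/
noncomputable def raceRank (w : 𝒴 → ℝ) (num : 𝒴 → ℕ) (z : 𝒴 → ℝ) (y : 𝒴) : ℝ≥0∞ :=
  ∑' y', {z | Precedes w num z y' y}.indicator 1 z

variable {w : 𝒴 → ℝ} {num : 𝒴 → ℕ} {z : 𝒴 → ℝ}

theorem Precedes.trans {y₁ y₂ y₃ : 𝒴} (h₁ : Precedes w num z y₁ y₂)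
    (h₂ : Precedes w num z y₂ y₃) : Precedes w num z y₁ y₃ := by
  refine ⟨h₁.1, ?_⟩
  rcases h₁.2 with h | ⟨h, h'⟩ <;> rcases h₂.2 with k | ⟨k, k'⟩
  · exact Or.inl (h.trans k)
  · exact Or.inl (h.trans_eq k)
  · exact Or.inl (h.trans_lt k)
  · exact Or.inr ⟨h.trans k, h'.trans k'⟩

theorem not_precedes_self (y : 𝒴) : ¬ Precedes w num z y y := by
  simp [Precedes]

theorem Precedes.raceRank_add_one_le {y₁ y₂ : 𝒴} (h : Precedes w num z y₁ y₂) :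
    raceRank w num z y₁ + 1 ≤ raceRank w num z y₂ := by
  classical
  have h1 : ∑' y', (if y' = y₁ then (1 : ℝ≥0∞) else 0) = 1 := tsum_ite_eq y₁ _
  calc raceRank w num z y₁ + 1
      = ∑' y', ({z | Precedes w num z y' y₁}.indicator 1 z + if y' = y₁ then 1 else 0) := by
        rw [ENNReal.tsum_add, h1, raceRank]
    _ ≤ raceRank w num z y₂ := by
        refine ENNReal.tsum_le_tsum fun y' => ?_
        simp only [Set.indicator_apply, Set.mem_ofPred_eq, Pi.one_apply]
        by_cases hy : y' = y₁
        · subst hy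
          simp [h, not_precedes_self]
        · by_cases hp : Precedes w num z y' y₁
          · simp [hp, hp.trans h, hy]
          · simp [hp, hy]

theorem eq_of_floor_raceRank_eq (hnum : Function.Injective num) {y₁ y₂ : 𝒴} (hw₁ : 0 < w y₁)
    (hw₂ : 0 < w y₂) (hf₁ : raceRank w num z y₁ ≠ ⊤) (hf₂ : raceRank w num z y₂ ≠ ⊤)
    (h : ⌊(raceRank w num z y₁).toReal⌋₊ = ⌊(raceRank w num z y₂).toReal⌋₊) : y₁ = y₂ := by
  have key : ∀ y y' : 𝒴, raceRank w num z y' ≠ ⊤ → Precedes w num z y y' →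
      ⌊(raceRank w num z y).toReal⌋₊ ≠ ⌊(raceRank w num z y').toReal⌋₊ := by
    intro y y' hf hp
    have hle := ENNReal.toReal_mono hf hp.raceRank_add_one_le
    have hf' : raceRank w num z y ≠ ⊤ :=
      ne_top_of_le_ne_top hf (le_self_add.trans hp.raceRank_add_one_le)
    rw [ENNReal.toReal_add hf' ENNReal.one_ne_top, ENNReal.toReal_one] at hle
    have := Nat.floor_le_floor hle
    rw [Nat.floor_add_one ENNReal.toReal_nonneg] at this
    omega
  by_contra hne
  have hnn : num y₁ ≠ num y₂ := fun hn => hne (hnum hn)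
  rcases lt_trichotomy (z y₁ / w y₁) (z y₂ / w y₂) with hlt | heq | hgt
  · exact key _ _ hf₂ ⟨hw₁, Or.inl hlt⟩ h
  · rcases hnn.lt_or_gt with hl | hl
    · exact key _ _ hf₂ ⟨hw₁, Or.inr ⟨heq, hl⟩⟩ h
    · exact key _ _ hf₁ ⟨hw₂, Or.inr ⟨heq.symm, hl⟩⟩ h.symm
  · exact key _ _ hf₁ ⟨hw₂, Or.inl hgt⟩ h.symm

theorem raceRank_ne_top (hfin : ∀ t : ℝ, {y | z y ≤ t * w y}.Finite) (y : 𝒴) :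
    raceRank w num z y ≠ ⊤ := by
  have hs : {y' | Precedes w num z y' y}.Finite := by
    refine (hfin (z y / w y)).subset fun y' hy' => ?_
    refine (div_le_iff₀ hy'.1).1 ?_
    rcases hy'.2 with h | h
    · exact h.le
    · exact h.1.le
  rw [raceRank, tsum_eq_sum (s := hs.toFinset) fun y' hy' => ?_]
  · refine ENNReal.sum_ne_top.2 fun y' _ => ?_
    exact ne_top_of_le_ne_top ENNReal.one_ne_top (Set.indicator_le_self' (by simp) z)
  · exact Set.indicator_of_notMem (s := {z | Precedes w num z y' y})
      (fun h => hy' (hs.mem_toFinset.2 h)) _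

theorem measurableSet_precedes (w : 𝒴 → ℝ) (num : 𝒴 → ℕ) (y' y : 𝒴) :
    MeasurableSet {z | Precedes w num z y' y} := by
  have h1 : MeasurableSet {z : 𝒴 → ℝ | z y' / w y' < z y / w y} :=
    measurableSet_lt (by fun_prop) (by fun_prop)
  have h2 : MeasurableSet {z : 𝒴 → ℝ | z y' / w y' = z y / w y} :=
    measurableSet_eq_fun (by fun_prop) (by fun_prop)
  exact (MeasurableSet.const _).inter (h1.union (h2.inter (MeasurableSet.const _)))

theorem measurable_raceRank [Countable 𝒴] (w : 𝒴 → ℝ) (num : 𝒴 → ℕ) (y : 𝒴) :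
    Measurable fun z => raceRank w num z y :=
  Measurable.tsum fun y' =>
    (measurable_one.indicator (measurableSet_precedes w num y' y))

theorem setLIntegral_raceRank_le [Countable 𝒴] {p : 𝒴 → ℝ} (hp : ∀ y, 0 ≤ p y)
    (hp1 : HasSum p 1) (hw : ∀ y, 0 ≤ w y) (hw1 : HasSum w 1) {y : 𝒴} (hy : 0 < w y) :
    ∫⁻ z in {z | IsRaceWinner p z y}, raceRank w num z y ∂(clockMeasure 𝒴) ≤
      ENNReal.ofReal (p y ^ 2 / w y) := by
  have hterm : ∀ y', ∫⁻ z in {z | IsRaceWinner p z y},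
      {z | Precedes w num z y' y}.indicator 1 z ∂(clockMeasure 𝒴) ≤
        ENNReal.ofReal (p y ^ 2 / w y * w y') := by
    intro y'
    rw [lintegral_indicator_one (measurableSet_precedes w num y' y),
      Measure.restrict_apply (measurableSet_precedes w num y' y)]
    by_cases hyy : y' = y
    · subst hyy
      simp [not_precedes_self]
    · refine (measure_mono fun z hz => ?_).trans ((clockMeasure_isRaceWinner_before_le hp hp1 hyy
        (div_nonneg (hw y') hy.le)).trans_eq (by congr 1; ring))
      obtain ⟨⟨hy', h⟩, hwin⟩ := hz
      refine ⟨hwin, ?_⟩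
      have h' : z y' / w y' ≤ z y / w y := by
        rcases h with h | h
        · exact h.le
        · exact h.1.le
      rw [div_le_iff₀ hy'] at h'
      exact h'.trans_eq (by ring)
  calc ∫⁻ z in {z | IsRaceWinner p z y}, raceRank w num z y ∂(clockMeasure 𝒴)
      = ∑' y', ∫⁻ z in {z | IsRaceWinner p z y},
          {z | Precedes w num z y' y}.indicator 1 z ∂(clockMeasure 𝒴) :=
        lintegral_tsum fun y' =>
          (measurable_one.indicator (measurableSet_precedes w num y' y)).aemeasurable
    _ ≤ ∑' y', ENNReal.ofReal (p y ^ 2 / w y * w y') := ENNReal.tsum_le_tsum hterm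
    _ = ENNReal.ofReal (p y ^ 2 / w y) := by
        have hsum := hw1.mul_left (p y ^ 2 / w y)
        rw [← ENNReal.ofReal_tsum_of_nonneg (fun y' => by have := hw y'; positivity) hsum.summable,
          hsum.tsum_eq, mul_one]

theorem PMF.hasSum_toReal {α : Type*} (p : PMF α) : HasSum (fun a => (p a).toReal) 1 := by
  have h := ENNReal.hasSum_toReal (f := fun a => p a) (by simp [p.tsum_coe])
  rwa [← ENNReal.tsum_toReal_eq p.apply_ne_top, p.tsum_coe, ENNReal.toReal_one] at h

/-- Simulation of all kernels `Q x` dominated by a fixed output law `w` with common randomness,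
by sending an integer whose mean, given that `y` is produced, is at most `Q x y / w y`. -/
theorem exists_channel_simulation {𝒳 : Type} [Countable 𝒳] [Countable 𝒴]
    [MeasurableSpace 𝒳] [DiscreteMeasurableSpace 𝒳]
    [MeasurableSpace 𝒴] [DiscreteMeasurableSpace 𝒴] (Q : 𝒳 → PMF 𝒴) (w : PMF 𝒴) :
    ∃ (𝒵 : Type) (_ : MeasurableSpace 𝒵) (PZ : Measure 𝒵)
      (f : 𝒳 × 𝒵 → ℕ) (g : ℕ × 𝒵 → 𝒴),
      IsProbabilityMeasure PZ ∧ Measurable f ∧ Measurable g ∧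
      ∀ x, (∀ y, Q x y ≠ 0 → w y ≠ 0) → ∀ y,
        PZ {z | g (f (x, z), z) = y} = Q x y ∧
        ∫⁻ z in {z | g (f (x, z), z) = y}, (f (x, z) : ℝ≥0∞) ∂PZ ≤ Q x y * Q x y / w y := by
  obtain ⟨num, hnum⟩ := exists_injective_nat 𝒴
  have : Nonempty 𝒴 := w.support_nonempty.to_type
  let wr : 𝒴 → ℝ := fun y => (w y).toReal
  let p : 𝒳 → 𝒴 → ℝ := fun x y => (Q x y).toReal
  have hp : ∀ x y, 0 ≤ p x y := fun _ _ => ENNReal.toReal_nonneg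
  have hw : ∀ y, 0 ≤ wr y := fun _ => ENNReal.toReal_nonneg
  have hp1 : ∀ x, HasSum (p x) 1 := fun x => (Q x).hasSum_toReal
  have hw1 : HasSum wr 1 := w.hasSum_toReal
  have hpr : ∀ x y, ENNReal.ofReal (p x y) = Q x y :=
    fun x y => ENNReal.ofReal_toReal ((Q x).apply_ne_top y)
  have hwr : ∀ y, ENNReal.ofReal (wr y) = w y := fun y => ENNReal.ofReal_toReal (w.apply_ne_top y)
  choose W hWm hW using fun x => exists_measurable_selection
    (fun y => {z | IsRaceWinner (p x) z y}) (measurableSet_isRaceWinner (p x))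
  have hrk : ∀ y, Measurable fun z : 𝒴 → ℝ => ⌊(raceRank wr num z y).toReal⌋₊ :=
    fun y => Nat.measurable_floor.comp (measurable_raceRank wr num y).ennreal_toReal
  choose G hGm hG using fun k : ℕ => exists_measurable_selection
    (fun y => {z | 0 < wr y ∧ ⌊(raceRank wr num z y).toReal⌋₊ = k})
    (fun y => (MeasurableSet.const _).inter (hrk y (measurableSet_singleton k)))
  let f : 𝒳 × (𝒴 → ℝ) → ℕ := fun q => ⌊(raceRank wr num q.2 (W q.1 q.2)).toReal⌋₊
  let g : ℕ × (𝒴 → ℝ) → 𝒴 := fun q => G q.1 q.2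
  have hrk' : Measurable fun q : 𝒴 × (𝒴 → ℝ) => ⌊(raceRank wr num q.2 q.1).toReal⌋₊ :=
    measurable_from_prod_countable_right
      (f := fun q : 𝒴 × (𝒴 → ℝ) => ⌊(raceRank wr num q.2 q.1).toReal⌋₊) hrk
  have hfx : ∀ x, Measurable fun z => f (x, z) := fun x =>
    Measurable.comp (f := fun z : 𝒴 → ℝ => (W x z, z)) hrk' ((hWm x).prodMk measurable_id)
  refine ⟨𝒴 → ℝ, inferInstance, clockMeasure 𝒴, f, g, inferInstance, ?_, ?_, fun x hx => ?_⟩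
  · exact measurable_from_prod_countable_right (f := f) hfx
  · exact measurable_from_prod_countable_right (f := g) hGm
  have hae : ∀ᵐ z ∂(clockMeasure 𝒴), IsRaceWinner (p x) z (W x z) ∧
      g (f (x, z), z) = W x z := by
    filter_upwards [ae_exists_isRaceWinner (hp x) (hp1 x), ae_finite_clock_le hw hw1.summable]
      with z ⟨y, hy⟩ hfin
    have hwin := hW x z y hy
    refine ⟨hwin, ?_⟩
    have hpos : 0 < wr (W x z) := by
      refine ENNReal.toReal_pos (hx _ fun h0 => ?_) (w.apply_ne_top _)
      have := hwin.1
      simp [p, h0] at this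
    have hGz := hG (f (x, z)) z (W x z) ⟨hpos, rfl⟩
    exact eq_of_floor_raceRank_eq hnum hGz.1 hpos (raceRank_ne_top hfin _)
      (raceRank_ne_top hfin _) hGz.2
  have hgm : Measurable fun z => g (f (x, z), z) :=
    (measurable_from_prod_countable_right (f := g) hGm).comp ((hfx x).prodMk measurable_id)
  have hle : ∀ y, clockMeasure 𝒴 {z | g (f (x, z), z) = y} ≤ Q x y := by
    intro y
    rw [← hpr]
    refine (measure_mono_ae ?_).trans (clockMeasure_isRaceWinner_le (hp x) (hp1 x) y)
    filter_upwards [hae] with z hz hzy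
    have hzy' : g (f (x, z), z) = y := hzy
    rw [← hzy', hz.2]
    exact hz.1
  have hsum : ∑' y, clockMeasure 𝒴 {z | g (f (x, z), z) = y} = 1 := by
    have := (Measure.map (fun z => g (f (x, z), z)) (clockMeasure 𝒴)).tsum_indicator_apply_singleton
      Set.univ MeasurableSet.univ
    simp only [Set.indicator_univ] at this
    rw [Measure.map_apply hgm MeasurableSet.univ, Set.preimage_univ, measure_univ] at this
    rw [← this]
    refine tsum_congr fun y => ?_
    rw [Measure.map_apply hgm (measurableSet_singleton y)]
    rfl
  intro y
  refine ⟨?_, ?_⟩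
  · refine le_antisymm (hle y) ?_
    by_contra! hlt
    have := ENNReal.tsum_lt_tsum (by simp [hsum]) hle hlt
    rw [hsum, (Q x).tsum_coe] at this
    exact lt_irrefl _ this
  · by_cases hy : Q x y = 0
    · rw [setLIntegral_measure_zero _ _ (le_antisymm ((hle y).trans_eq hy) zero_le)]
      exact zero_le
    have hpos : 0 < wr y := ENNReal.toReal_pos (hx y hy) (w.apply_ne_top y)
    calc ∫⁻ z in {z | g (f (x, z), z) = y}, (f (x, z) : ℝ≥0∞) ∂(clockMeasure 𝒴)
        ≤ ∫⁻ z in {z | g (f (x, z), z) = y}, raceRank wr num z y ∂(clockMeasure 𝒴) := by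
          refine setLIntegral_mono_ae' (hgm (measurableSet_singleton y)) ?_
          filter_upwards [hae, ae_finite_clock_le hw hw1.summable] with z hz hfin hzy
          have hWy : W x z = y := hz.2.symm.trans hzy
          simp only [f, hWy]
          rw [← ENNReal.ofReal_natCast, ← ENNReal.ofReal_toReal (raceRank_ne_top hfin y)]
          exact ENNReal.ofReal_le_ofReal
            (by simpa using Nat.floor_le (ENNReal.toReal_nonneg (a := raceRank wr num z y)))
      _ ≤ ∫⁻ z in {z | IsRaceWinner (p x) z y}, raceRank wr num z y ∂(clockMeasure 𝒴) := by
          refine lintegral_mono_set' ?_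
          filter_upwards [hae] with z hz hzy
          have hzy' : g (f (x, z), z) = y := hzy
          rw [← hzy', hz.2]
          exact hz.1
      _ ≤ ENNReal.ofReal (p x y ^ 2 / wr y) :=
          setLIntegral_raceRank_le (hp x) (hp1 x) hw hw1 hpos
      _ = Q x y * Q x y / w y := by
          rw [ENNReal.ofReal_div_of_pos hpos, sq, ENNReal.ofReal_mul (hp x y), hpr, hwr]

end RaceRank

section EntropyBound

theorem mul_rpow_neg_le_sub {a b β : ℝ} (ha : 0 < a) (hb : 0 < b) (hβ : 0 < β) :
    β * (b - a) * b ^ (-(1 + β)) ≤ a ^ (-β) - b ^ (-β) := by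
  have hab : 0 < a / b := div_pos ha hb
  have h1 : 1 + β * (1 - a / b) ≤ (a / b) ^ (-β) := by
    rw [Real.rpow_def_of_pos hab]
    have h2 := Real.add_one_le_exp (Real.log (a / b) * -β)
    have h3 := Real.log_le_sub_one_of_pos hab
    nlinarith
  have h4 : a ^ (-β) = b ^ (-β) * (a / b) ^ (-β) := by
    rw [← Real.mul_rpow hb.le hab.le, mul_div_cancel₀ _ hb.ne']
  have h5 : b ^ (-(1 + β)) = b ^ (-β) / b := by
    rw [show -(1 + β) = -β - 1 by ring, Real.rpow_sub_one hb.ne']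
  have h6 : 0 < b ^ (-β) := Real.rpow_pos_of_pos hb _
  rw [h4, h5]
  have h7 : β * (b - a) * (b ^ (-β) / b) = b ^ (-β) * (β * (1 - a / b)) := by
    field_simp
  rw [h7]
  nlinarith

theorem sum_range_one_add_div_rpow_le {m β : ℝ} (hm : 0 < m) (hβ : 0 < β) (n : ℕ) :
    ∑ k ∈ Finset.range (n + 1), (1 + k / m) ^ (-(1 + β)) ≤
      1 + m / β * (1 - (1 + n / m) ^ (-β)) := by
  induction n with
  | zero => simp
  | succ n ih =>
    rw [Finset.sum_range_succ]
    have h := mul_rpow_neg_le_sub (a := 1 + n / m) (b := 1 + (n + 1 : ℕ) / m) (by positivity)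
      (by positivity) hβ
    have h1 : β * (1 + ((n + 1 : ℕ) : ℝ) / m - (1 + n / m)) = β / m := by
      push_cast
      ring
    rw [h1] at h
    have h2 := mul_le_mul_of_nonneg_left h (by positivity : 0 ≤ m / β)
    rw [← mul_assoc, show m / β * (β / m) = 1 by field_simp, one_mul] at h2
    linarith

theorem sum_range_one_add_div_rpow_le_const {m β : ℝ} (hm : 1 ≤ m) (hβ : 0 < β) (n : ℕ) :
    ∑ k ∈ Finset.range n, (1 + k / m) ^ (-(1 + β)) ≤ m * (1 + 1 / β) := by
  have hm0 : 0 < m := by linarith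
  calc ∑ k ∈ Finset.range n, (1 + k / m) ^ (-(1 + β))
      ≤ ∑ k ∈ Finset.range (n + 1), (1 + k / m) ^ (-(1 + β)) := by
        rw [Finset.sum_range_succ]
        exact le_add_of_nonneg_right (by positivity)
    _ ≤ 1 + m / β * (1 - (1 + n / m) ^ (-β)) := sum_range_one_add_div_rpow_le hm0 hβ n
    _ ≤ 1 + m / β * 1 := by
        gcongr
        exact sub_le_self _ (by positivity)
    _ ≤ m * (1 + 1 / β) := by
        rw [mul_one, mul_add, mul_one, mul_one_div]
        linarith

theorem PMF.toReal_le_one {α : Type*} (p : PMF α) (a : α) : (p a).toReal ≤ 1 :=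
  ENNReal.toReal_le_of_le_ofReal zero_le_one (by simpa using p.coe_le_one a)

theorem neg_mul_logb_nonneg {x : ℝ} (h0 : 0 ≤ x) (h1 : x ≤ 1) : 0 ≤ -(x * Real.logb 2 x) :=
  neg_nonneg.2 (mul_nonpos_of_nonneg_of_nonpos h0 (Real.logb_nonpos one_lt_two h0 h1))

theorem ent2_nonneg {α : Type*} (p : PMF α) : 0 ≤ ent2 p :=
  tsum_nonneg fun a => neg_mul_logb_nonneg ENNReal.toReal_nonneg (p.toReal_le_one a)

theorem ofReal_ent2_le_cross_entropy {α : Type*} (p : PMF α) {V : α → ℝ} (hV : ∀ a, 0 < V a)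
    (hV1 : ∀ a, V a ≤ 1) (hVs : Summable V) (hVt : ∑' a, V a ≤ 1) :
    ENNReal.ofReal (ent2 p) ≤ ∑' a, p a * ENNReal.ofReal (-Real.logb 2 (V a)) := by
  have hlog2 : 0 < Real.log 2 := Real.log_pos one_lt_two
  have hterm : ∀ a, p a * ENNReal.ofReal (-Real.logb 2 (V a)) =
      ENNReal.ofReal ((p a).toReal * -Real.logb 2 (V a)) := by
    intro a
    rw [ENNReal.ofReal_mul ENNReal.toReal_nonneg, ENNReal.ofReal_toReal (p.apply_ne_top a)]
  have hnonneg : ∀ a, 0 ≤ (p a).toReal * -Real.logb 2 (V a) := fun a =>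
    mul_nonneg ENNReal.toReal_nonneg
      (neg_nonneg.2 (Real.logb_nonpos one_lt_two (hV a).le (hV1 a)))
  simp_rw [hterm]
  by_cases htop : ∑' a, ENNReal.ofReal ((p a).toReal * -Real.logb 2 (V a)) = ⊤
  · rw [htop]
    exact le_top
  have hts : Summable fun a => (p a).toReal * -Real.logb 2 (V a) := by
    have := ENNReal.summable_toReal htop
    simpa only [ENNReal.toReal_ofReal (hnonneg _)] using this
  rw [← ENNReal.ofReal_tsum_of_nonneg hnonneg hts]
  refine ENNReal.ofReal_le_ofReal ?_
  have hp := p.hasSum_toReal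
  have hle : ∀ a, -((p a).toReal * Real.logb 2 (p a).toReal) ≤
      (p a).toReal * -Real.logb 2 (V a) + (V a - (p a).toReal) / Real.log 2 := by
    intro a
    rcases (ENNReal.toReal_nonneg (a := p a)).eq_or_lt with h0 | h0
    · rw [← h0]
      have := hV a
      simp only [zero_mul, neg_zero, sub_zero, zero_add]
      positivity
    · have h1 := Real.log_le_sub_one_of_pos (div_pos (hV a) h0)
      rw [Real.log_div (hV a).ne' h0.ne'] at h1
      have h2 := mul_le_mul_of_nonneg_left h1 h0.le
      rw [mul_sub, mul_sub, mul_one, mul_div_cancel₀ _ h0.ne'] at h2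
      have h3 := div_le_div_of_nonneg_right h2 hlog2.le
      simp only [Real.logb]
      have h4 : ((p a).toReal * Real.log (V a) - (p a).toReal * Real.log (p a).toReal) /
          Real.log 2 = (p a).toReal * (Real.log (V a) / Real.log 2) -
            (p a).toReal * (Real.log (p a).toReal / Real.log 2) := by
        ring
      linarith
  have hdiff := (hVs.hasSum.sub hp).div_const (Real.log 2)
  have hmaj := hts.hasSum.add hdiff
  have hes : Summable fun a => -((p a).toReal * Real.logb 2 (p a).toReal) :=
    Summable.of_nonneg_of_le
      (fun a => neg_mul_logb_nonneg ENNReal.toReal_nonneg (p.toReal_le_one a)) hle hmaj.summable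
  have hfin := hasSum_le hle hes.hasSum hmaj
  refine hfin.trans (add_le_of_nonpos_right ?_)
  exact div_nonpos_of_nonpos_of_nonneg (by linarith) hlog2.le

theorem ofReal_ent2_le_log_moment (p : PMF ℕ) {m β : ℝ} (hm : 1 ≤ m) (hβ : 0 < β) :
    ENNReal.ofReal (ent2 p) ≤ ∑' k, p k *
      (ENNReal.ofReal (1 + β) * ENNReal.ofReal (Real.logb 2 (1 + k / m)) +
        ENNReal.ofReal (Real.logb 2 (m * (1 + 1 / β)))) := by
  have hm0 : 0 < m := by linarith
  set C := m * (1 + 1 / β) with hC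
  have hC1 : 1 ≤ C := one_le_mul_of_one_le_of_one_le hm (by simp [hβ.le])
  have hC0 : 0 < C := by linarith
  have hpos : ∀ k : ℕ, 0 < 1 + (k : ℝ) / m := fun k => by positivity
  have hone : ∀ k : ℕ, 1 ≤ 1 + (k : ℝ) / m := fun k => le_add_of_nonneg_right (by positivity)
  have hnn : ∀ k : ℕ, 0 ≤ (1 + (k : ℝ) / m) ^ (-(1 + β)) := fun k => by positivity
  have hs : Summable fun k : ℕ => (1 + (k : ℝ) / m) ^ (-(1 + β)) :=
    summable_of_sum_range_le hnn (sum_range_one_add_div_rpow_le_const hm hβ)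
  have ht : ∑' k : ℕ, (1 + (k : ℝ) / m) ^ (-(1 + β)) ≤ C :=
    Real.tsum_le_of_sum_range_le hnn (sum_range_one_add_div_rpow_le_const hm hβ)
  have hV := ofReal_ent2_le_cross_entropy p
    (V := fun k : ℕ => (1 + (k : ℝ) / m) ^ (-(1 + β)) / C)
    (fun k => div_pos (Real.rpow_pos_of_pos (hpos k) _) hC0)
    (fun k => (div_le_one hC0).2
      ((Real.rpow_le_one_of_one_le_of_nonpos (hone k) (by linarith)).trans hC1))
    (hs.div_const C) (by rw [tsum_div_const]; exact (div_le_one hC0).2 ht)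
  refine hV.trans_eq (tsum_congr fun k => ?_)
  rw [Real.logb_div (Real.rpow_pos_of_pos (hpos k) _).ne' hC0.ne',
    Real.logb_rpow_eq_mul_logb_of_pos (hpos k), ← ENNReal.ofReal_mul (by positivity),
    ← ENNReal.ofReal_add (mul_nonneg (by positivity) (Real.logb_nonneg one_lt_two (hone k)))
      (Real.logb_nonneg one_lt_two hC1)]
  congr 2
  ring

theorem setLIntegral_logb_one_add_le {Z : Type*} [MeasurableSpace Z] (P : Measure Z)
    (N : Z → ℕ) {S : Set Z} {m r : ℝ} (hm : 0 < m) (hr : 0 ≤ r)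
    (hN : ∫⁻ z in S, (N z : ℝ≥0∞) ∂P ≤ P S * ENNReal.ofReal (m * r)) :
    ∫⁻ z in S, ENNReal.ofReal (Real.logb 2 (1 + N z / m)) ∂P ≤
      P S * ENNReal.ofReal (Real.logb 2 (1 + r)) := by
  have hlog2 : 0 < Real.log 2 := Real.log_pos one_lt_two
  have hr1 : 0 < 1 + r := by positivity
  set A := Real.logb 2 (1 + r) - r / (1 + r) / Real.log 2 with hA
  set D := 1 / (m * (1 + r) * Real.log 2) with hD
  have hA0 : 0 ≤ A := by
    have h1 := Real.log_le_sub_one_of_pos (inv_pos.2 hr1)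
    rw [Real.log_inv] at h1
    have h2 : r / (1 + r) = 1 - (1 + r)⁻¹ := by
      field_simp
      ring
    rw [hA, Real.logb, ← sub_div, h2]
    exact div_nonneg (by linarith) hlog2.le
  have hD0 : 0 ≤ D := by positivity
  have hpt : ∀ z, ENNReal.ofReal (Real.logb 2 (1 + N z / m)) ≤
      ENNReal.ofReal A + ENNReal.ofReal D * N z := by
    intro z
    rw [← ENNReal.ofReal_natCast (N z), ← ENNReal.ofReal_mul hD0,
      ← ENNReal.ofReal_add hA0 (by positivity)]
    refine ENNReal.ofReal_le_ofReal ?_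
    have hNz : 0 < 1 + (N z : ℝ) / m := by positivity
    have h1 := Real.log_le_sub_one_of_pos (div_pos hNz hr1)
    rw [Real.log_div hNz.ne' hr1.ne'] at h1
    have h2 := div_le_div_of_nonneg_right h1 hlog2.le
    have h3 : A + D * N z = Real.logb 2 (1 + r) +
        ((1 + N z / m) / (1 + r) - 1) / Real.log 2 := by
      rw [hA, hD]
      field_simp
      ring
    rw [h3, Real.logb, Real.logb]
    rw [sub_div] at h2
    linarith
  calc ∫⁻ z in S, ENNReal.ofReal (Real.logb 2 (1 + N z / m)) ∂P
      ≤ ∫⁻ z in S, (ENNReal.ofReal A + ENNReal.ofReal D * N z) ∂P := lintegral_mono hpt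
    _ = ENNReal.ofReal A * P S + ENNReal.ofReal D * ∫⁻ z in S, (N z : ℝ≥0∞) ∂P := by
        rw [lintegral_add_left measurable_const, setLIntegral_const,
          lintegral_const_mul' _ _ ENNReal.ofReal_ne_top]
    _ ≤ ENNReal.ofReal A * P S + ENNReal.ofReal D * (P S * ENNReal.ofReal (m * r)) := by
        gcongr
    _ = P S * ENNReal.ofReal (A + D * (m * r)) := by
        rw [ENNReal.ofReal_add hA0 (by positivity), ENNReal.ofReal_mul hD0]
        ring
    _ = P S * ENNReal.ofReal (Real.logb 2 (1 + r)) := by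
        congr 2
        rw [hA, hD]
        field_simp
        ring

end EntropyBound

section MutualInformation

variable {𝒳 𝒴 : Type*} (μ : PMF 𝒳) (Q : 𝒳 → PMF 𝒴)

theorem jointPMF_apply (x : 𝒳) (y : 𝒴) : jointPMF μ Q (x, y) = μ x * Q x y := by
  classical
  rw [jointPMF, PMF.bind_apply, tsum_eq_single x]
  · rw [PMF.map_apply, tsum_eq_single y]
    · simp
    · intro y' hy'
      simp [hy'.symm]
  · intro x' hx'
    rw [PMF.map_apply]
    simp [hx'.symm]

theorem hasSum_joint_toReal :
    HasSum (fun p : 𝒳 × 𝒴 => (μ p.1 * Q p.1 p.2).toReal) 1 := by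
  simpa only [← jointPMF_apply] using (jointPMF μ Q).hasSum_toReal

theorem hasSum_product_toReal :
    HasSum (fun p : 𝒳 × 𝒴 => (μ p.1).toReal * ((μ.bind Q) p.2).toReal) 1 := by
  simpa only [ENNReal.toReal_mul] using hasSum_joint_toReal μ fun _ => μ.bind Q

theorem mul_le_bind_apply (x : 𝒳) (y : 𝒴) : μ x * Q x y ≤ (μ.bind Q) y := by
  rw [PMF.bind_apply]
  exact ENNReal.le_tsum x

theorem toReal_pos_of_joint_pos {p : 𝒳 × 𝒴} (h : 0 < (μ p.1 * Q p.1 p.2).toReal) :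
    0 < (μ p.1).toReal ∧ 0 < (Q p.1 p.2).toReal ∧ 0 < ((μ.bind Q) p.2).toReal := by
  refine ⟨?_, ?_, h.trans_le (ENNReal.toReal_mono (PMF.apply_ne_top _ _)
    (mul_le_bind_apply μ Q p.1 p.2))⟩
  · rw [ENNReal.toReal_mul] at h
    exact pos_of_mul_pos_left h ENNReal.toReal_nonneg
  · rw [ENNReal.toReal_mul] at h
    exact pos_of_mul_pos_right h ENNReal.toReal_nonneg

theorem sub_div_le_miSummand (p : 𝒳 × 𝒴) :
    ((μ p.1 * Q p.1 p.2).toReal - (μ p.1).toReal * ((μ.bind Q) p.2).toReal) / Real.log 2 ≤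
      miSummand μ Q p := by
  have hlog2 : 0 < Real.log 2 := Real.log_pos one_lt_two
  rcases (ENNReal.toReal_nonneg (a := μ p.1 * Q p.1 p.2)).eq_or_lt with h | h
  · rw [miSummand, ← h, zero_mul, zero_sub, neg_div]
    exact neg_nonpos.2 (by positivity)
  · obtain ⟨h1, h2, h3⟩ := toReal_pos_of_joint_pos μ Q h
    rw [miSummand, Real.logb, ← mul_div_assoc, ENNReal.toReal_mul]
    refine div_le_div_of_nonneg_right ?_ hlog2.le
    have h4 := Real.log_le_sub_one_of_pos (div_pos h3 h2)
    rw [Real.log_div h3.ne' h2.ne'] at h4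
    rw [Real.log_div h2.ne' h3.ne']
    have h5 := mul_le_mul_of_nonneg_left h4 (mul_pos h1 h2).le
    have h6 : (μ p.1).toReal * (Q p.1 p.2).toReal *
        (((μ.bind Q) p.2).toReal / (Q p.1 p.2).toReal - 1) =
        (μ p.1).toReal * ((μ.bind Q) p.2).toReal - (μ p.1).toReal * (Q p.1 p.2).toReal := by
      field_simp
    linarith

theorem mutInfo_nonneg {μ : PMF 𝒳} {Q : 𝒳 → PMF 𝒴} (hs : Summable (miSummand μ Q)) :
    0 ≤ mutInfo μ Q := by
  have h := hasSum_le (sub_div_le_miSummand μ Q)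
    (((hasSum_joint_toReal μ Q).sub (hasSum_product_toReal μ Q)).div_const (Real.log 2)) hs.hasSum
  simpa [mutInfo] using h

theorem mul_logb_one_add_le_miSummand (p : 𝒳 × 𝒴) :
    (μ p.1 * Q p.1 p.2).toReal *
        Real.logb 2 (1 + (Q p.1 p.2).toReal / ((μ.bind Q) p.2).toReal) ≤
      miSummand μ Q p + (μ p.1).toReal * ((μ.bind Q) p.2).toReal / Real.log 2 := by
  have hlog2 : 0 < Real.log 2 := Real.log_pos one_lt_two
  rcases (ENNReal.toReal_nonneg (a := μ p.1 * Q p.1 p.2)).eq_or_lt with h | h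
  · rw [miSummand, ← h, zero_mul, zero_mul, zero_add]
    positivity
  · obtain ⟨h1, h2, h3⟩ := toReal_pos_of_joint_pos μ Q h
    have hr : 0 < (Q p.1 p.2).toReal / ((μ.bind Q) p.2).toReal := div_pos h2 h3
    rw [miSummand, Real.logb, Real.logb, ← mul_div_assoc, ← mul_div_assoc, ← add_div,
      ENNReal.toReal_mul]
    refine div_le_div_of_nonneg_right ?_ hlog2.le
    set r := (Q p.1 p.2).toReal / ((μ.bind Q) p.2).toReal with hrdef
    have h4 := Real.log_le_sub_one_of_pos (div_pos (by positivity : 0 < 1 + r) hr)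
    rw [Real.log_div (by positivity) hr.ne'] at h4
    have h5 := mul_le_mul_of_nonneg_left h4 (mul_pos h1 h2).le
    have h6 : (μ p.1).toReal * (Q p.1 p.2).toReal * ((1 + r) / r - 1) =
        (μ p.1).toReal * ((μ.bind Q) p.2).toReal := by
      rw [hrdef]
      field_simp
      ring
    linarith

theorem tsum_joint_mul_logb_one_add_le {μ : PMF 𝒳} {Q : 𝒳 → PMF 𝒴}
    (hs : Summable (miSummand μ Q)) :
    ∑' p : 𝒳 × 𝒴, μ p.1 * (Q p.1 p.2 *
        ENNReal.ofReal (Real.logb 2 (1 + (Q p.1 p.2).toReal / ((μ.bind Q) p.2).toReal))) ≤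
      ENNReal.ofReal (mutInfo μ Q + 1 / Real.log 2) := by
  have hsum := hs.hasSum.add ((hasSum_product_toReal μ Q).div_const (Real.log 2))
  have hnn : ∀ p : 𝒳 × 𝒴, 0 ≤ (μ p.1 * Q p.1 p.2).toReal *
      Real.logb 2 (1 + (Q p.1 p.2).toReal / ((μ.bind Q) p.2).toReal) := fun p =>
    mul_nonneg ENNReal.toReal_nonneg
      (Real.logb_nonneg one_lt_two (le_add_of_nonneg_right (by positivity)))
  have hle := mul_logb_one_add_le_miSummand μ Q
  rw [mutInfo, ← hsum.tsum_eq, ENNReal.ofReal_tsum_of_nonneg (fun p => (hnn p).trans (hle p))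
    hsum.summable]
  refine ENNReal.tsum_le_tsum fun p => ?_
  rw [← mul_assoc, ← ENNReal.ofReal_toReal (a := μ p.1 * Q p.1 p.2)
    (ENNReal.mul_ne_top (PMF.apply_ne_top _ _) (PMF.apply_ne_top _ _)),
    ← ENNReal.ofReal_mul ENNReal.toReal_nonneg]
  exact ENNReal.ofReal_le_ofReal (hle p)

end MutualInformation

section Achievability

theorem PMF.tsum_map_apply_mul {α β : Type*} (p : PMF α) (F : α → β) (φ : β → ℝ≥0∞) :
    ∑' b, (p.map F) b * φ b = ∑' a, p a * φ (F a) := by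
  classical
  simp_rw [PMF.map_apply, ← ENNReal.tsum_mul_right]
  rw [ENNReal.tsum_comm]
  refine tsum_congr fun a => ?_
  rw [tsum_eq_single (F a)]
  · simp
  · intro b hb
    simp [hb]

theorem PMF.toMeasure_eq_tsum_ite {α : Type*} [MeasurableSpace α] [DiscreteMeasurableSpace α]
    (p : PMF α) (s : Set α) [DecidablePred (· ∈ s)] :
    p.toMeasure s = ∑' a, if a ∈ s then p a else 0 := by
  rw [p.toMeasure_apply (MeasurableSet.of_discrete)]
  exact tsum_congr fun a => by simp [Set.indicator_apply]

variable {𝒳 𝒴 𝒵 : Type*} [MeasurableSpace 𝒳] [MeasurableSpace 𝒵] {PZ : Measure 𝒵} {f : 𝒳 × 𝒵 → ℕ}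

theorem measurable_map_apply [Countable 𝒳] (μ : PMF 𝒳) (hf : Measurable f) (k : ℕ) :
    Measurable fun z => (μ.map fun x => f (x, z)) k := by
  simp_rw [PMF.map_apply]
  exact Measurable.tsum fun x => Measurable.ite
    (measurableSet_eq_fun measurable_const (hf.comp measurable_prodMk_left))
    measurable_const measurable_const

theorem isCondDistrib_map [Countable 𝒳] [DiscreteMeasurableSpace 𝒳] [IsProbabilityMeasure PZ]
    (μ : PMF 𝒳) (hf : Measurable f) :
    IsCondDistrib (μ.toMeasure.prod PZ) (fun ω => f ω) Prod.snd
      fun z => μ.map fun x => f (x, z) := by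
  classical
  refine ⟨measurable_map_apply μ hf, fun k A hA => ?_⟩
  have hS : MeasurableSet {ω : 𝒳 × 𝒵 | f ω = k ∧ ω.2 ∈ A} :=
    (hf (measurableSet_singleton k)).inter (measurable_snd hA)
  rw [Measure.map_snd_prod, measure_univ, one_smul, Measure.prod_apply_symm hS,
    ← lintegral_indicator hA]
  refine lintegral_congr fun z => ?_
  by_cases hz : z ∈ A
  · rw [Set.indicator_of_mem hz, PMF.toMeasure_eq_tsum_ite, PMF.map_apply]
    refine tsum_congr fun x => ?_
    simp [hz, eq_comm]
  · simp [hz]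

theorem map_prod_eq_jointPMF_toMeasure [Countable 𝒳] [DiscreteMeasurableSpace 𝒳]
    [Countable 𝒴] [MeasurableSpace 𝒴] [DiscreteMeasurableSpace 𝒴] [IsProbabilityMeasure PZ]
    (μ : PMF 𝒳) (Q : 𝒳 → PMF 𝒴) {Y : 𝒳 × 𝒵 → 𝒴} (hY : Measurable Y)
    (hQ : ∀ x, μ x ≠ 0 → ∀ y, PZ {z | Y (x, z) = y} = Q x y) :
    (μ.toMeasure.prod PZ).map (fun ω => (ω.1, Y ω)) = (jointPMF μ Q).toMeasure := by
  refine Measure.ext_of_singleton fun ⟨x, y⟩ => ?_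
  rw [Measure.map_apply (measurable_fst.prodMk hY) (measurableSet_singleton _),
    PMF.toMeasure_apply_singleton _ _ (measurableSet_singleton _), jointPMF_apply]
  have hpre : (fun ω : 𝒳 × 𝒵 => (ω.1, Y ω)) ⁻¹' {(x, y)} = {x} ×ˢ {z | Y (x, z) = y} := by
    ext ⟨x', z⟩
    simp only [Set.mem_preimage, Set.mem_singleton_iff, Prod.mk.injEq, Set.mem_prod,
      Set.mem_ofPred_eq]
    exact and_congr_right fun h => by rw [h]
  rw [hpre, Measure.prod_prod, PMF.toMeasure_apply_singleton _ _ (measurableSet_singleton _)]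
  by_cases hx : μ x = 0
  · simp [hx]
  · rw [hQ x hx]

theorem lintegral_logb_one_add_le [Countable 𝒴] [MeasurableSpace 𝒴] [DiscreteMeasurableSpace 𝒴]
    (p w q : PMF 𝒴) {Y : 𝒵 → 𝒴} {N : 𝒵 → ℕ} {m : ℝ} (hm : 0 < m) (hY : Measurable Y)
    (hp : ∀ y, PZ {z | Y z = y} = p y)
    (hN : ∀ y, ∫⁻ z in {z | Y z = y}, (N z : ℝ≥0∞) ∂PZ ≤ p y * p y / w y)
    (hq : ∀ y, p y ≠ 0 → q y ≠ 0) (hqw : ∀ y, q y ≤ ENNReal.ofReal m * w y) :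
    ∫⁻ z, ENNReal.ofReal (Real.logb 2 (1 + N z / m)) ∂PZ ≤
      ∑' y, p y * ENNReal.ofReal (Real.logb 2 (1 + (p y).toReal / (q y).toReal)) := by
  have hcov : ⋃ y, {z | Y z = y} = Set.univ := by
    ext z
    simp
  rw [← setLIntegral_univ, ← hcov, lintegral_iUnion (s := fun y => {z | Y z = y})
    (fun y => hY (measurableSet_singleton y))
    (fun y y' hne => Set.disjoint_left.2 fun z hz hz' => hne (hz.symm.trans hz'))]
  refine ENNReal.tsum_le_tsum fun y => ?_
  rw [← hp y]
  refine setLIntegral_logb_one_add_le PZ N hm (by positivity) ((hN y).trans ?_)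
  rw [hp y]
  by_cases hy : p y = 0
  · simp [hy]
  have hqy : 0 < (q y).toReal := ENNReal.toReal_pos (hq y hy) (q.apply_ne_top y)
  rw [ENNReal.ofReal_mul hm.le, ENNReal.ofReal_div_of_pos hqy,
    ENNReal.ofReal_toReal (p.apply_ne_top y), ENNReal.ofReal_toReal (q.apply_ne_top y),
    mul_div_assoc]
  gcongr
  rw [← mul_div_assoc]
  have hw : w y ≠ 0 := fun h0 => hq y hy (le_antisymm (by simpa [h0] using hqw y) zero_le)
  refine (ENNReal.div_le_iff_le_mul (Or.inl hw) (Or.inl (w.apply_ne_top y))).2 ?_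
  rw [← ENNReal.mul_div_right_comm]
  refine (ENNReal.le_div_iff_mul_le (Or.inl (hq y hy)) (Or.inl (q.apply_ne_top y))).2 ?_
  calc p y * q y ≤ p y * (ENNReal.ofReal m * w y) := by gcongr; exact hqw y
    _ = ENNReal.ofReal m * p y * w y := by ring

theorem integral_ent2_map_le [Countable 𝒳] [IsProbabilityMeasure PZ] (μ : PMF 𝒳) (hf : Measurable f)
    {m G : ℝ} (hm : 1 ≤ m) (hG : 0 < G)
    (hlog : ∑' x, μ x * ∫⁻ z, ENNReal.ofReal (Real.logb 2 (1 + f (x, z) / m)) ∂PZ ≤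
      ENNReal.ofReal G) :
    ∫ z, ent2 (μ.map fun x => f (x, z)) ∂PZ ≤ G + 1 + Real.logb 2 (m * (1 + G)) := by
  have hC : 0 ≤ Real.logb 2 (m * (1 + G)) :=
    Real.logb_nonneg one_lt_two (one_le_mul_of_one_le_of_one_le hm (by linarith))
  have hB : 0 ≤ G + 1 + Real.logb 2 (m * (1 + G)) := by linarith
  refine (Real.le_norm_self _).trans ((norm_integral_le_lintegral_norm _).trans
    (ENNReal.toReal_le_of_le_ofReal hB ?_))
  have hpt : ∀ z, ENNReal.ofReal ‖ent2 (μ.map fun x => f (x, z))‖ ≤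
      ∑' x, μ x * (ENNReal.ofReal (1 + 1 / G) *
        ENNReal.ofReal (Real.logb 2 (1 + f (x, z) / m)) +
          ENNReal.ofReal (Real.logb 2 (m * (1 + G)))) := by
    intro z
    rw [Real.norm_of_nonneg (ent2_nonneg _)]
    have h := ofReal_ent2_le_log_moment (μ.map fun x => f (x, z)) hm (one_div_pos.2 hG)
    rw [PMF.tsum_map_apply_mul] at h
    simpa only [one_div_one_div] using h
  have hmeas : ∀ x, Measurable fun z => ENNReal.ofReal (Real.logb 2 (1 + f (x, z) / m)) := by
    intro x
    have : Measurable fun n : ℕ => ENNReal.ofReal (Real.logb 2 (1 + n / m)) :=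
      measurable_of_countable _
    exact this.comp (hf.comp measurable_prodMk_left)
  have hmeas' : ∀ x, Measurable fun z => ENNReal.ofReal (1 + 1 / G) *
      ENNReal.ofReal (Real.logb 2 (1 + f (x, z) / m)) +
        ENNReal.ofReal (Real.logb 2 (m * (1 + G))) :=
    fun x => ((hmeas x).const_mul _).add measurable_const
  calc ∫⁻ z, ENNReal.ofReal ‖ent2 (μ.map fun x => f (x, z))‖ ∂PZ
      ≤ ∫⁻ z, ∑' x, μ x * (ENNReal.ofReal (1 + 1 / G) *
        ENNReal.ofReal (Real.logb 2 (1 + f (x, z) / m)) +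
          ENNReal.ofReal (Real.logb 2 (m * (1 + G)))) ∂PZ := lintegral_mono hpt
    _ = ∑' x, (ENNReal.ofReal (1 + 1 / G) *
          (μ x * ∫⁻ z, ENNReal.ofReal (Real.logb 2 (1 + f (x, z) / m)) ∂PZ) +
            μ x * ENNReal.ofReal (Real.logb 2 (m * (1 + G)))) := by
        rw [lintegral_tsum fun x => ((hmeas' x).const_mul _).aemeasurable]
        refine tsum_congr fun x => ?_
        rw [lintegral_const_mul _ (hmeas' x),
          lintegral_add_right _ measurable_const, lintegral_const_mul _ (hmeas x),
          lintegral_const, measure_univ]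
        ring
    _ ≤ ENNReal.ofReal (1 + 1 / G) * ENNReal.ofReal G +
          ENNReal.ofReal (Real.logb 2 (m * (1 + G))) := by
        rw [ENNReal.tsum_add, ENNReal.tsum_mul_left, ENNReal.tsum_mul_right, μ.tsum_coe, one_mul]
        gcongr
    _ = ENNReal.ofReal (G + 1 + Real.logb 2 (m * (1 + G))) := by
        rw [← ENNReal.ofReal_mul (by positivity), ← ENNReal.ofReal_add (by positivity) hC]
        congr 2
        field_simp

theorem tsum_lintegral_logb_one_add_le [Countable 𝒴] [MeasurableSpace 𝒴]
    [DiscreteMeasurableSpace 𝒴] {μ : PMF 𝒳} {Q : 𝒳 → PMF 𝒴} (hs : Summable (miSummand μ Q))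
    (w : PMF 𝒴) {Y : 𝒳 × 𝒵 → 𝒴} {m : ℝ} (hm : 0 < m) (hY : Measurable Y)
    (hQ : ∀ x, μ x ≠ 0 → ∀ y, PZ {z | Y (x, z) = y} = Q x y ∧
      ∫⁻ z in {z | Y (x, z) = y}, (f (x, z) : ℝ≥0∞) ∂PZ ≤ Q x y * Q x y / w y)
    (hw : ∀ y, (μ.bind Q) y ≤ ENNReal.ofReal m * w y) :
    ∑' x, μ x * ∫⁻ z, ENNReal.ofReal (Real.logb 2 (1 + f (x, z) / m)) ∂PZ ≤
      ENNReal.ofReal (mutInfo μ Q + 1 / Real.log 2) := by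
  refine le_trans ?_ (tsum_joint_mul_logb_one_add_le hs)
  rw [ENNReal.tsum_prod (f := fun x y => μ x * (Q x y *
    ENNReal.ofReal (Real.logb 2 (1 + (Q x y).toReal / ((μ.bind Q) y).toReal))))]
  refine ENNReal.tsum_le_tsum fun x => ?_
  by_cases hx : μ x = 0
  · simp [hx]
  rw [ENNReal.tsum_mul_left]
  gcongr
  refine lintegral_logb_one_add_le (Q x) w (μ.bind Q) hm (hY.comp measurable_prodMk_left)
    (fun y => (hQ x hx y).1) (fun y => (hQ x hx y).2) (fun y hy h0 => ?_) hw
  have h1 := mul_le_bind_apply μ Q x y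
  rw [h0] at h1
  exact mul_ne_zero hx hy (le_antisymm h1 zero_le)

theorem bind_apply_le_card_mul_mixture {𝒳 𝒴 ι : Type*} [Fintype ι] [Nonempty ι]
    (μS : ι → PMF 𝒳) (Q : 𝒳 → PMF 𝒴) (α : ι) (y : 𝒴) :
    ((μS α).bind Q) y ≤ ENNReal.ofReal (Fintype.card ι) *
      ((PMF.uniformOfFintype ι).bind fun α => (μS α).bind Q) y := by
  have hcard : (Fintype.card ι : ℝ≥0∞) ≠ 0 := by simp
  rw [ENNReal.ofReal_natCast]
  calc ((μS α).bind Q) y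
      = Fintype.card ι * (PMF.uniformOfFintype ι α * ((μS α).bind Q) y) := by
        rw [PMF.uniformOfFintype_apply, ← mul_assoc,
          ENNReal.mul_inv_cancel hcard (ENNReal.natCast_ne_top _), one_mul]
    _ ≤ _ := by
        gcongr
        exact mul_le_bind_apply (PMF.uniformOfFintype ι) (fun α => (μS α).bind Q) α y

theorem robustOneShotAchievable_of_mutInfo_le {𝒳 𝒴 : Type} [Countable 𝒳] [Countable 𝒴]
    [MeasurableSpace 𝒳] [DiscreteMeasurableSpace 𝒳]
    [MeasurableSpace 𝒴] [DiscreteMeasurableSpace 𝒴]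
    {ι : Type} [Fintype ι] [Nonempty ι] {M : ℕ}
    {μS : ι → PMF 𝒳} {h : Fin M → PMF (𝒳 × 𝒴) → ℝ} {θ : Fin M → ℝ} {Q : 𝒳 → PMF 𝒴}
    (hQ : Q ∈ constraintSet μS h θ) (hs : ∀ α, Summable (miSummand (μS α) Q)) {t : ℝ}
    (ht : ∀ α, mutInfo (μS α) Q ≤ t) :
    RobustOneShotAchievable μS h θ
      (t + 1 / Real.log 2 + 1 + Real.logb 2 (Fintype.card ι * (1 + (t + 1 / Real.log 2)))) := by
  have hlog2 : 0 < Real.log 2 := Real.log_pos one_lt_two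
  set w := (PMF.uniformOfFintype ι).bind fun α => (μS α).bind Q with hwdef
  obtain ⟨𝒵, _, PZ, f, g, hPZ, hf, hg, hsim⟩ := exists_channel_simulation Q w
  have hw := bind_apply_le_card_mul_mixture μS Q
  have hm : (1 : ℝ) ≤ Fintype.card ι := by exact_mod_cast Fintype.card_pos
  have hY : Measurable fun ω : 𝒳 × 𝒵 => g (f ω, ω.2) := hg.comp (hf.prodMk measurable_snd)
  refine ⟨𝒵, _, PZ, f, g, hPZ, hf, hg, fun α => ?_⟩
  have hsimα : ∀ x, μS α x ≠ 0 → ∀ y, PZ {z | g (f (x, z), z) = y} = Q x y ∧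
      ∫⁻ z in {z | g (f (x, z), z) = y}, (f (x, z) : ℝ≥0∞) ∂PZ ≤ Q x y * Q x y / w y := by
    refine fun x hx => hsim x fun y hy h0 => mul_ne_zero hx hy (le_antisymm ?_ zero_le)
    simpa [← hwdef, h0] using (mul_le_bind_apply (μS α) Q x y).trans (hw α y)
  refine ⟨⟨_, isCondDistrib_map (μS α) hf, integral_ent2_map_le (μS α) hf hm ?_ ?_⟩,
    jointPMF (μS α) Q, map_prod_eq_jointPMF_toMeasure (μS α) Q hY fun x hx y => (hsimα x hx y).1,
    hQ α⟩
  · have := (mutInfo_nonneg (hs α)).trans (ht α)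
    positivity
  · refine (tsum_lintegral_logb_one_add_le (hs α) w (by linarith) hY hsimα (hw α)).trans
      (ENNReal.ofReal_le_ofReal ?_)
    gcongr
    exact ht α

theorem RobustOneShotAchievable.mono {𝒳 𝒴 : Type} [MeasurableSpace 𝒳] [MeasurableSpace 𝒴]
    {ι : Type*} {M : ℕ} {μS : ι → PMF 𝒳} {h : Fin M → PMF (𝒳 × 𝒴) → ℝ}
    {θ : Fin M → ℝ} {R R' : ℝ} (hach : RobustOneShotAchievable μS h θ R) (hR : R ≤ R') :
    RobustOneShotAchievable μS h θ R' := by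
  obtain ⟨𝒵, _, PZ, f, g, hPZ, hf, hg, hα⟩ := hach
  refine ⟨𝒵, _, PZ, f, g, hPZ, hf, hg, fun α => ?_⟩
  obtain ⟨⟨κ, hκ, hle⟩, hjoint⟩ := hα α
  exact ⟨⟨κ, hκ, hle.trans hR⟩, hjoint⟩

theorem rate_bound_le {t m : ℝ} (ht : 0 ≤ t) (hm : 0 < m) :
    t + 1 / Real.log 2 + 1 + Real.logb 2 (m * (1 + (t + 1 / Real.log 2))) ≤
      t + Real.logb 2 (m * (t + 1)) + 4 := by
  have hlog2 := Real.log_two_gt_d9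
  have hinv : 1 / Real.log 2 ≤ 3 / 2 := by
    rw [div_le_iff₀ (by linarith)]
    linarith
  have hinv0 : 0 < 1 / Real.log 2 := by
    have : 0 < Real.log 2 := by linarith
    positivity
  have h52 : Real.logb 2 (5 / 2) ≤ 3 / 2 := by
    have h1 : Real.logb 2 ((5 / 2) ^ 2) ≤ Real.logb 2 (2 ^ 3) :=
      Real.logb_le_logb_of_le one_lt_two (by norm_num) (by norm_num)
    rw [Real.logb_pow, Real.logb_pow, Real.logb_self_eq_one one_lt_two] at h1
    push_cast at h1
    linarith
  have h2 : Real.logb 2 (m * (1 + (t + 1 / Real.log 2))) ≤ Real.logb 2 (5 / 2 * (m * (t + 1))) := by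
    refine Real.logb_le_logb_of_le one_lt_two (by positivity) ?_
    rw [mul_left_comm]
    gcongr
    linarith
  rw [Real.logb_mul (x := 5 / 2) (by norm_num) (by positivity)] at h2
  linarith

theorem Rbar_nonneg {𝒳 𝒴 ι : Type*} {M : ℕ} (μS : ι → PMF 𝒳)
    (h : Fin M → PMF (𝒳 × 𝒴) → ℝ) (θ : Fin M → ℝ) : 0 ≤ Rbar μS h θ := by
  refine Real.sInf_nonneg ?_
  rintro _ ⟨Q, -, hs, rfl⟩
  exact Real.iSup_nonneg fun α => mutInfo_nonneg (hs α)

theorem exists_mutInfo_le_of_Rbar_lt {𝒳 𝒴 ι : Type*} [Finite ι] {M : ℕ} {μS : ι → PMF 𝒳}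
    {h : Fin M → PMF (𝒳 × 𝒴) → ℝ} {θ : Fin M → ℝ} (hfeas : RIRFFeasible μS h θ) {t : ℝ}
    (ht : Rbar μS h θ < t) :
    ∃ Q ∈ constraintSet μS h θ, (∀ α, Summable (miSummand (μS α) Q)) ∧
      ∀ α, mutInfo (μS α) Q ≤ t := by
  obtain ⟨Q₀, hQ₀, hs₀⟩ := hfeas
  have hne : {r | ∃ Q ∈ constraintSet μS h θ,
      (∀ α, Summable (miSummand (μS α) Q)) ∧ r = ⨆ α, mutInfo (μS α) Q}.Nonempty :=
    ⟨_, Q₀, hQ₀, hs₀, rfl⟩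
  obtain ⟨_, ⟨Q, hQ, hs, rfl⟩, hlt⟩ := exists_lt_of_csInf_lt hne ht
  exact ⟨Q, hQ, hs, fun α => (le_ciSup (Set.finite_range _).bddAbove α).trans hlt.le⟩

end Achievability

/-- **One-shot achievability for the robust information rate function.**
For a finite family of sources, a finite family of fidelity constraints with levels `θ`,
and a feasible robust information rate function `R̄(θ)`, every rate
`R > R̄(θ) + log₂(m (R̄(θ) + 1)) + 4` is robust one-shot achievable. -/
theorem robust_one_shot_achievability
    {𝒳 𝒴 : Type} [Countable 𝒳] [Countable 𝒴]
    [MeasurableSpace 𝒳] [DiscreteMeasurableSpace 𝒳]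
    [MeasurableSpace 𝒴] [DiscreteMeasurableSpace 𝒴]
    {ι : Type} [Fintype ι] [Nonempty ι] {M : ℕ}
    (μS : ι → PMF 𝒳) (h : Fin M → PMF (𝒳 × 𝒴) → ℝ) (θ : Fin M → ℝ)
    (hfeas : RIRFFeasible μS h θ)
    (R : ℝ)
    (hR : R > Rbar μS h θ +
      Real.logb 2 ((Fintype.card ι : ℝ) * (Rbar μS h θ + 1)) + 4) :
    RobustOneShotAchievable μS h θ R := by
  set ρ := Rbar μS h θ with hρ
  have hρ0 : 0 ≤ ρ := Rbar_nonneg μS h θ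
  have hm : (0 : ℝ) < Fintype.card ι := by exact_mod_cast Fintype.card_pos
  have hcont : ContinuousAt
      (fun t : ℝ => t + Real.logb 2 ((Fintype.card ι : ℝ) * (t + 1)) + 4) ρ := by
    have hne : (Fintype.card ι : ℝ) * (ρ + 1) ≠ 0 := by positivity
    simp only [Real.logb]
    fun_prop (disch := assumption)
  have hev : ∀ᶠ t in nhdsWithin ρ (Set.Ioi ρ),
      t + Real.logb 2 ((Fintype.card ι : ℝ) * (t + 1)) + 4 < R :=
    (hcont.eventually_lt_const hR).filter_mono nhdsWithin_le_nhds
  obtain ⟨t, htR, hρt⟩ := (hev.and self_mem_nhdsWithin).exists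
  obtain ⟨Q, hQ, hs, ht⟩ := exists_mutInfo_le_of_Rbar_lt hfeas hρt
  exact (robustOneShotAchievable_of_mutInfo_le hQ hs ht).mono
    ((rate_bound_le (hρ0.trans (le_of_lt hρt)) hm).trans htR.le)
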